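/- There exists a probability density ρ on ℝ^d (namely ρ(x) proportional to ∏_{i=1}^d (sinc(x^{(i)}/(2d+2)))^{2d+2}, where sinc(x) = sin(x)/x) with the following properties: (1) ρ ≥ 0, ∫_{ℝ^d} ρ(x) dx = 1, and ∫_{B(0,(2d+2)^{3/2})} ρ(x) dx ≥ c₂ with 2c₂ − 1 ≥ 1 − 4/(9π), where B(0,r) is the closed Euclidean ball of radius r centered at 0; (2) ∫_{ℝ^d} ρ(x) (‖x‖₁)^{d+1} dx < +∞; (3) the Fourier transform ρ̂(ζ) = ∫_{ℝ^d} e^{i⟨ζ,x⟩} ρ(x) dx is supported in the cube [−1,1]^d; (4) ρ̂ is of class C^{2d}, and for every multi-index β with |β| ≤ 2d, ‖∂^{|β|}ρ̂/∂ζ^β‖_∞ ≤ 2^{1+d/2} π^{−d/2} (2d+2)^{|β|+d/2}. -/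

import Mathlib

open MeasureTheory Filter
open scoped Topology ENNReal BigOperators

noncomputable section

/-- The (unnormalized) sine cardinal, `sinc x = sin x / x` with `sinc 0 = 1`. -/
def sinc (x : ℝ) : ℝ := if x = 0 then 1 else Real.sin x / x

/-- Partial derivative of a function `f : ℝ^d → ℂ` of order `r` in the coordinate directions
`j 0, …, j (r-1)`; for a multi-index `β` this represents `∂^{|β|} f / ∂ζ^β`. -/
def pderivMulti {d : ℕ} (f : EuclideanSpace ℝ (Fin d) → ℂ) (r : ℕ) (j : Fin r → Fin d)
    (ζ : EuclideanSpace ℝ (Fin d)) : ℂ :=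
  iteratedFDeriv ℝ r f ζ fun k => EuclideanSpace.single (j k) 1

/-- The Fourier transform `ĝ(ζ) = ∫ e^{i⟨ζ,x⟩} g(x) dx` of an (integrable) density on `ℝ^d`. -/
def fourierDensity {d : ℕ} (g : EuclideanSpace ℝ (Fin d) → ℝ)
    (ζ : EuclideanSpace ℝ (Fin d)) : ℂ :=
  ∫ x, Complex.exp (Complex.I * ((∑ i, ζ i * x i : ℝ) : ℂ)) * (g x : ℂ)


lemma sk_abs_mul (u : ℝ) : |Real.sinc u| * |u| ≤ 1 := by
  by_cases h : u = 0
  · simp [h]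
  · rw [Real.sinc_of_ne_zero h, ← abs_mul, div_mul_cancel₀ _ h]
    exact Real.abs_sin_le_one u

lemma sk_abs_mul' (u : ℝ) : |Real.sinc u| * (1 + |u|) ≤ 2 := by
  have := sk_abs_mul u
  have := Real.abs_sinc_le_one u
  linarith

lemma sk_decay (n k : ℕ) (h : k + 2 ≤ n) (u : ℝ) :
    |Real.sinc u| ^ n * (1 + |u|) ^ k ≤ 2 ^ (k + 2) * (1 + u ^ 2)⁻¹ := by
  have h0 := abs_nonneg (Real.sinc u)
  have h1 := Real.abs_sinc_le_one u
  have h2 := sk_abs_mul' u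
  have e : |Real.sinc u| ^ n ≤ |Real.sinc u| ^ (k + 2) := pow_le_pow_of_le_one h0 h1 h
  have hu : 0 < 1 + |u| := by positivity
  rw [← div_eq_mul_inv, le_div_iff₀ (by positivity)]
  have h3 : 1 + u ^ 2 ≤ (1 + |u|) ^ 2 := by
    have := sq_abs u
    nlinarith [abs_nonneg u]
  calc |Real.sinc u| ^ n * (1 + |u|) ^ k * (1 + u ^ 2)
      ≤ |Real.sinc u| ^ (k + 2) * (1 + |u|) ^ k * (1 + |u|) ^ 2 := by gcongr
    _ = (|Real.sinc u| * (1 + |u|)) ^ (k + 2) := by rw [mul_pow]; ring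
    _ ≤ 2 ^ (k + 2) := by gcongr

lemma sk_integrable (n k : ℕ) (h : k + 2 ≤ n) :
    Integrable (fun u : ℝ => |Real.sinc u| ^ n * (1 + |u|) ^ k) := by
  refine (integrable_inv_one_add_sq.const_mul (2 ^ (k + 2))).mono' ?_ ?_
  · have := Real.continuous_sinc
    exact Continuous.aestronglyMeasurable (by fun_prop)
  · filter_upwards with u
    rw [Real.norm_of_nonneg (by positivity)]
    exact sk_decay n k h u

lemma sk_integrable' (n : ℕ) (h : 2 ≤ n) :
    Integrable (fun u : ℝ => Real.sinc u ^ n) := by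
  refine (sk_integrable n 0 (by omega)).mono' ?_ ?_
  · have := Real.continuous_sinc
    exact Continuous.aestronglyMeasurable (by fun_prop)
  · filter_upwards with u
    simp

/-- triangle function -/
def skTri (x : ℝ) : ℂ := ((max 0 (2 - |x|) : ℝ) : ℂ)

lemma skTri_cont : Continuous skTri := by unfold skTri; fun_prop

lemma skTri_supp (x : ℝ) (h : 2 ≤ |x|) : skTri x = 0 := by
  unfold skTri; rw [max_eq_left (by linarith)]; simp

lemma skTri_integrable : Integrable skTri := by
  apply skTri_cont.integrable_of_hasCompactSupport
  apply HasCompactSupport.intro (isCompact_Icc (a := -2) (b := (2:ℝ)))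
  intro x hx
  apply skTri_supp
  by_contra! h
  exact hx (abs_le.1 h.le)

lemma skTri_int (s : ℂ) (hs : s ≠ 0) :
    ∫ x : ℝ, Complex.exp (s * x) * skTri x = ((Complex.exp s - Complex.exp (-s)) / s) ^ 2 := by
  have h1 : ∫ x : ℝ, Complex.exp (s * x) * skTri x
      = ∫ x in (-2:ℝ)..2, Complex.exp (s * x) * skTri x := by
    rw [intervalIntegral.integral_of_le (by norm_num), setIntegral_eq_integral_of_forall_compl_eq_zero]
    intro x hx
    rw [skTri_supp, mul_zero]
    by_contra! h
    rw [abs_lt] at h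
    exact hx ⟨h.1, h.2.le⟩
  have hc : Continuous fun x : ℝ => Complex.exp (s * x) * skTri x := by
    have := skTri_cont
    fun_prop
  rw [h1, ← intervalIntegral.integral_add_adjacent_intervals (b := 0)
    (hc.intervalIntegrable _ _) (hc.intervalIntegrable _ _)]
  have h2 : ∫ x in (-2:ℝ)..0, Complex.exp (s * x) * skTri x
      = ∫ x in (-2:ℝ)..0, Complex.exp (s * x) * (2 + x) := by
    apply intervalIntegral.integral_congr
    intro x hx
    rw [Set.uIcc_of_le (by norm_num)] at hx
    simp only [skTri]
    rw [abs_of_nonpos hx.2, max_eq_right (by linarith [hx.1])]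
    push_cast; ring
  have h3 : ∫ x in (0:ℝ)..2, Complex.exp (s * x) * skTri x
      = ∫ x in (0:ℝ)..2, Complex.exp (s * x) * (2 - x) := by
    apply intervalIntegral.integral_congr
    intro x hx
    rw [Set.uIcc_of_le (by norm_num)] at hx
    simp only [skTri]
    rw [abs_of_nonneg hx.1, max_eq_right (by linarith [hx.2])]
    push_cast; ring
  have hd : ∀ x : ℝ, HasDerivAt (fun x : ℝ => Complex.exp (s * x)) (Complex.exp (s * x) * s) x := by
    intro x
    have := ((hasDerivAt_id (x:ℂ)).const_mul s).cexp.comp_ofReal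
    simpa using this
  have hi : ∀ x : ℝ, HasDerivAt (fun x : ℝ => (x:ℂ)) 1 x := fun x => Complex.ofRealCLM.hasDerivAt
  have h4 : ∫ x in (-2:ℝ)..0, Complex.exp (s * x) * (2 + x)
      = _ := intervalIntegral.integral_eq_sub_of_hasDerivAt
        (f := fun x : ℝ => Complex.exp (s * x) * (2 + x) / s - Complex.exp (s * x) / s ^ 2)
        (fun x _ => by
          have := ((((hd x).mul ((hi x).const_add 2)).div_const s).sub ((hd x).div_const (s ^ 2)))
          refine this.congr_deriv ?_
          field_simp; ring) (by apply Continuous.intervalIntegrable; fun_prop)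
  have h5 : ∫ x in (0:ℝ)..2, Complex.exp (s * x) * (2 - x)
      = _ := intervalIntegral.integral_eq_sub_of_hasDerivAt
        (f := fun x : ℝ => Complex.exp (s * x) * (2 - x) / s + Complex.exp (s * x) / s ^ 2)
        (fun x _ => by
          have := ((((hd x).mul ((hi x).const_sub 2)).div_const s).add ((hd x).div_const (s ^ 2)))
          refine this.congr_deriv ?_
          field_simp; ring) (by apply Continuous.intervalIntegrable; fun_prop)
  rw [h2, h3, h4, h5]
  have e1 : Complex.exp (s * (2:ℝ)) = Complex.exp s ^ 2 := by
    rw [← Complex.exp_nat_mul]; push_cast; ring_nf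
  have e2 : Complex.exp (s * (-2:ℝ)) = Complex.exp (-s) ^ 2 := by
    rw [← Complex.exp_nat_mul]; push_cast; ring_nf
  have e3 : Complex.exp s * Complex.exp (-s) = 1 := by rw [← Complex.exp_add]; simp
  rw [e1, e2]
  simp only [Complex.ofReal_zero, mul_zero, Complex.exp_zero]
  push_cast
  field_simp
  linear_combination 2 * e3

open FourierTransform in
lemma sk_base (w : ℝ) (hw : 2 ≤ |w|) :
    ∫ t : ℝ, Complex.exp (Complex.I * (w * t : ℝ)) * (Real.sinc t ^ 2 : ℝ) = 0 := by
  have hF : ∀ ξ : ℝ, ξ ≠ 0 → 𝓕 skTri ξ = ((4 * Real.sinc (2 * Real.pi * ξ) ^ 2 : ℝ) : ℂ) := by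
    intro ξ hξ
    have hs : (-(2 * Real.pi * ξ) * Complex.I : ℂ) ≠ 0 := by
      simp [hξ, Real.pi_ne_zero]
    have := skTri_int _ hs
    rw [Real.fourier_real_eq_integral_exp_smul]
    have hh : (2 * Real.pi * ξ) ≠ 0 := by positivity
    rw [Real.sinc_of_ne_zero hh]
    convert this using 1
    · congr 1; ext x
      rw [smul_eq_mul]; congr 2; push_cast; ring
    · rw [show -(-(2 * (Real.pi:ℂ) * ξ) * Complex.I) = ((2 * Real.pi * ξ : ℝ) : ℂ) * Complex.I by
        push_cast; ring,
        show (-(2 * (Real.pi:ℂ) * ξ) * Complex.I) = ((-(2 * Real.pi * ξ) : ℝ) : ℂ) * Complex.I by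
        push_cast; ring, Complex.exp_mul_I, Complex.exp_mul_I]
      push_cast
      rw [Complex.cos_neg, Complex.sin_neg]
      have : (ξ:ℂ) ≠ 0 := by exact_mod_cast hξ
      have : (Real.pi:ℂ) ≠ 0 := by exact_mod_cast Real.pi_ne_zero
      field_simp
      ring_nf
  have hae : (fun ξ : ℝ => ((4 * Real.sinc (2 * Real.pi * ξ) ^ 2 : ℝ) : ℂ)) =ᵐ[volume] 𝓕 skTri := by
    filter_upwards [compl_mem_ae_iff.2 (measure_singleton (0:ℝ))] with ξ hξ
    exact (hF ξ hξ).symm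
  have hpi : (2 * Real.pi) ≠ 0 := by positivity
  have hI : Integrable (𝓕 skTri) := by
    refine Integrable.congr ?_ hae
    exact (((sk_integrable' 2 le_rfl).comp_mul_left' hpi).const_mul 4).ofReal
  have inv := skTri_integrable.fourierInv_fourier_eq hI (v := w) skTri_cont.continuousAt
  rw [skTri_supp w hw, Real.fourierInv_eq'] at inv
  have h2 : ∫ ξ : ℝ, (fun t : ℝ => Complex.exp (Complex.I * (w * t : ℝ)) * (Real.sinc t ^ 2 : ℝ))
      (2 * Real.pi * ξ) = 0 := by
    have h3 : (4:ℂ) * ∫ ξ : ℝ, (fun t : ℝ => Complex.exp (Complex.I * (w * t : ℝ)) *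
      (Real.sinc t ^ 2 : ℝ)) (2 * Real.pi * ξ) = 0 := by
      rw [← integral_const_mul, ← inv]
      apply integral_congr_ae
      filter_upwards [hae] with ξ hξ
      rw [← hξ]
      simp only [smul_eq_mul, RCLike.inner_apply, conj_trivial]
      push_cast
      rw [show Complex.I * (w * (2 * Real.pi * ξ)) = 2 * Real.pi * (w * ξ) * Complex.I by ring]
      ring
    simpa using h3
  rw [Measure.integral_comp_mul_left (fun t : ℝ => Complex.exp (Complex.I * (w * t : ℝ)) *
      (Real.sinc t ^ 2 : ℝ)) (2 * Real.pi)] at h2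
  simpa [Real.pi_ne_zero] using h2

lemma sk_fourier (k : ℕ) (hk : 2 ≤ k) : ∀ w : ℝ, (k : ℝ) ≤ |w| →
    ∫ t : ℝ, Complex.exp (Complex.I * (w * t : ℝ)) * (Real.sinc t ^ k : ℝ) = 0 := by
  induction k, hk using Nat.le_induction with
  | base => intro w hw; exact sk_base w (by exact_mod_cast hw)
  | succ k hk ih =>
    intro w hw
    have hs : ∀ t : ℝ, (Real.sinc t : ℂ) = (1/2) * ∫ s in Set.Ioc (-1:ℝ) 1,
        Complex.exp (s * t * Complex.I) := by
      intro t
      by_cases ht : t = 0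
      · simp [ht]
        norm_num
      have h0 := integral_exp_mul_I_eq_sinc t
      rw [← intervalIntegral.integral_of_le (by norm_num)]
      have h1 := intervalIntegral.integral_comp_mul_right (a := -1) (b := 1)
        (fun x : ℝ => Complex.exp (x * Complex.I)) ht
      simp only [neg_mul, one_mul] at h1
      rw [h0] at h1
      push_cast at h1
      rw [h1]
      have : (t:ℂ) ≠ 0 := by exact_mod_cast ht
      rw [Complex.real_smul]
      push_cast
      field_simp
    have h1 : ∀ t : ℝ, Complex.exp (Complex.I * (w * t : ℝ)) * (Real.sinc t ^ (k+1) : ℝ)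
        = (1/2) * ∫ s in Set.Ioc (-1:ℝ) 1, Complex.exp (Complex.I * ((w + s) * t : ℝ)) *
          (Real.sinc t ^ k : ℝ) := by
      intro t
      rw [integral_mul_const, Complex.ofReal_pow, pow_succ]
      have : ∫ s in Set.Ioc (-1:ℝ) 1, Complex.exp (Complex.I * ((w + s) * t : ℝ))
          = Complex.exp (Complex.I * (w * t : ℝ)) * ∫ s in Set.Ioc (-1:ℝ) 1,
        Complex.exp (s * t * Complex.I) := by
        rw [← integral_const_mul]
        congr 1; ext s
        rw [← Complex.exp_add]; congr 1; push_cast; ring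
      rw [this]
      push_cast
      linear_combination Complex.exp (Complex.I * (w * t)) * (Real.sinc t : ℂ) ^ k * hs t
    simp_rw [h1]
    rw [integral_const_mul, integral_integral_swap]
    · rw [setIntegral_eq_zero_of_forall_eq_zero, mul_zero]
      intro s hs
      apply ih
      push_cast at hw
      have : |s| ≤ 1 := abs_le.2 ⟨hs.1.le, hs.2⟩
      have := abs_sub_abs_le_abs_sub w (-s)
      rw [abs_neg, sub_neg_eq_add] at this
      linarith
    · have hi : Integrable (fun p : ℝ × ℝ => ((Real.sinc p.1 ^ k : ℝ) : ℂ) * (1:ℂ))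
          (volume.prod (volume.restrict (Set.Ioc (-1:ℝ) 1))) :=
        Integrable.mul_prod (f := fun t : ℝ => ((Real.sinc t ^ k : ℝ) : ℂ)) (g := fun _ => (1:ℂ))
          (sk_integrable' k hk).ofReal (integrable_const _)
      refine hi.mono ?_ ?_
      · have := Real.continuous_sinc
        apply Continuous.aestronglyMeasurable
        simp only [Function.uncurry_def]
        fun_prop
      · filter_upwards with p
        simp only [Function.uncurry_def, norm_mul, mul_comm Complex.I, Complex.norm_exp_ofReal_mul_I]
        simp


lemma sk_mom_integrable (n k : ℕ) (h : k + 2 ≤ n) :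
    Integrable (fun u : ℝ => |u| ^ k * |Real.sinc u| ^ n) := by
  refine (sk_integrable n k h).mono' ?_ ?_
  · have := Real.continuous_sinc
    exact Continuous.aestronglyMeasurable (by fun_prop)
  · filter_upwards with u
    rw [Real.norm_of_nonneg (by positivity), mul_comm]
    gcongr
    linarith

lemma sk_tail (k q : ℕ) (hq : 1 ≤ q) (a : ℝ) (ha : 0 < a) :
    ∫ u in {u : ℝ | a < |u|}, |u| ^ k * |Real.sinc u| ^ (k + q + 1) ≤ 2 * ((a ^ q)⁻¹ / q) := by
  have hq' : (0:ℝ) < q := by exact_mod_cast hq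
  have hms : MeasurableSet {u : ℝ | a < |u|} := measurableSet_lt measurable_const measurable_norm
  set g : ℝ → ℝ := (Set.Ioi a).indicator (fun v => v ^ (-(q + 1 : ℝ))) with hg
  have hgi : Integrable g := by
    rw [hg, integrable_indicator_iff measurableSet_Ioi]
    exact integrableOn_Ioi_rpow_of_lt (by linarith) ha
  have hgi2 : Integrable (fun u => g u + g (-u)) := hgi.add hgi.comp_neg
  have hval : ∫ u, g u = (a ^ q)⁻¹ / q := by
    rw [hg, integral_indicator measurableSet_Ioi, integral_Ioi_rpow_of_lt (by linarith) ha]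
    rw [show (-(q + 1 : ℝ) + 1) = -(q:ℝ) by ring, Real.rpow_neg ha.le, Real.rpow_natCast, neg_div_neg_eq]
  have hval2 : ∫ u, g u + g (-u) = 2 * ((a ^ q)⁻¹ / q) := by
    rw [integral_add hgi hgi.comp_neg, integral_neg_eq_self, hval]; ring
  rw [← hval2, ← integral_indicator hms]
  apply integral_mono ?_ hgi2
  · intro u
    have hgn : ∀ v, 0 ≤ g v := fun v => by
      apply Set.indicator_nonneg
      intro x hx
      exact Real.rpow_nonneg (ha.trans hx).le _
    have hb : ∀ v : ℝ, a < v → |Real.sinc v| * v ≤ 1 → v ^ k * |Real.sinc v| ^ (k + q + 1) ≤ g v := by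
      intro v hv h1
      have hv0 : 0 < v := ha.trans hv
      rw [hg, Set.indicator_of_mem (by exact hv), Real.rpow_neg hv0.le,
        show ((q:ℝ) + 1) = ((q + 1 : ℕ) : ℝ) by push_cast; ring, Real.rpow_natCast,
        ← one_div, le_div_iff₀ (by positivity)]
      calc v ^ k * |Real.sinc v| ^ (k + q + 1) * v ^ (q + 1) = (|Real.sinc v| * v) ^ (k + q + 1) := by
            rw [mul_pow]; ring
        _ ≤ 1 := pow_le_one₀ (by positivity) h1
    by_cases hu : a < |u|
    · rw [Set.indicator_of_mem (by exact hu)]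
      have h1 := sk_abs_mul u
      rcases abs_cases u with ⟨h, h'⟩ | ⟨h, h'⟩
      · have := hb u (by rwa [h] at hu) (by rwa [h] at h1)
        rw [h]; linarith [hgn (-u)]
      · have := hb (-u) (by rwa [h] at hu) (by rw [Real.sinc_neg]; rwa [h] at h1)
        rw [Real.sinc_neg] at this
        rw [h]; linarith [hgn u]
    · rw [Set.indicator_of_notMem (by exact hu)]
      exact add_nonneg (hgn _) (hgn _)
  · exact (sk_mom_integrable _ k (by omega)).indicator hms

lemma sk_J_lower (n : ℕ) (hn : 4 ≤ n) :
    8 / (3 * Real.sqrt n) ≤ ∫ u : ℝ, |Real.sinc u| ^ n := by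
  have hn' : (4:ℝ) ≤ n := by exact_mod_cast hn
  have hs2 : (2:ℝ) ≤ Real.sqrt n := by
    rw [Real.le_sqrt (by norm_num) (by positivity)]; linarith
  have hsq : Real.sqrt n ^ 2 = n := Real.sq_sqrt (by positivity)
  set s := Real.sqrt n with hsdef
  have hs0 : 0 < s := by linarith
  set b := 2 / s with hb
  have hb1 : b ≤ 1 := by rw [hb, div_le_one hs0]; exact hs2
  have hb0 : 0 < b := by positivity
  have hnb : n * b ^ 2 = 4 := by rw [hb, ← hsq]; field_simp; norm_num
  have hint : Integrable (fun u : ℝ => |Real.sinc u| ^ n) := by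
    simpa using sk_mom_integrable n 0 (by omega)
  have key : ∀ u ∈ Set.Ioc (-b) b, 1 - n * u ^ 2 / 4 ≤ |Real.sinc u| ^ n := by
    intro u hu
    have hu1 : |u| ≤ b := abs_le.2 ⟨hu.1.le, hu.2⟩
    have h1 : 1 - u ^ 2 / 4 ≤ |Real.sinc u| := by
      by_cases h0 : u = 0
      · simp [h0]
      · have hpos : 0 < |u| := abs_pos.2 h0
        have := Real.sin_gt_sub_cube hpos
        have e : Real.sinc u = Real.sinc |u| := by
          rcases abs_cases u with ⟨h, _⟩ | ⟨h, _⟩ <;> rw [h]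
          rw [Real.sinc_neg]
        rw [e, Real.sinc_of_ne_zero hpos.ne']
        refine le_trans ?_ (le_abs_self _)
        rw [le_div_iff₀ hpos, ← sq_abs u]
        have h3 : 0 < |u| ^ 3 := by positivity
        nlinarith
    have hu2 : u ^ 2 ≤ 1 := by
      rw [← sq_abs]
      have := abs_nonneg u
      nlinarith
    calc 1 - n * u ^ 2 / 4 = 1 + n * (-(u ^ 2 / 4)) := by ring
      _ ≤ (1 + -(u ^ 2 / 4)) ^ n := one_add_mul_le_pow (by linarith) n
      _ ≤ |Real.sinc u| ^ n := by
        apply pow_le_pow_left₀ (by linarith)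
        linarith
  calc 8 / (3 * s) = ∫ u in (-b)..b, (1 - n * u ^ 2 / 4) := by
        rw [intervalIntegral.integral_sub (by simp) (by apply Continuous.intervalIntegrable; fun_prop)]
        simp only [mul_div_assoc]
        rw [intervalIntegral.integral_const_mul, intervalIntegral.integral_div, integral_pow]
        simp only [intervalIntegral.integral_const, smul_eq_mul]
        have : 8 / (3 * s) = 4 / 3 * b := by rw [hb]; field_simp; norm_num
        rw [this]
        push_cast
        linear_combination b / 6 * hnb
    _ = ∫ u in Set.Ioc (-b) b, (1 - n * u ^ 2 / 4) := by
        rw [intervalIntegral.integral_of_le (by linarith)]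
    _ ≤ ∫ u in Set.Ioc (-b) b, |Real.sinc u| ^ n := by
        apply setIntegral_mono_on _ hint.integrableOn measurableSet_Ioc key
        apply Continuous.integrableOn_Ioc
        fun_prop
    _ ≤ ∫ u : ℝ, |Real.sinc u| ^ n := by
        apply setIntegral_le_integral hint
        filter_upwards with u
        positivity

lemma sk_mom (k q : ℕ) (hq : 1 ≤ q) :
    ∫ u : ℝ, |u| ^ k * |Real.sinc u| ^ (k + q + 1) ≤
      (∫ u : ℝ, |Real.sinc u| ^ (k + q + 1)) + 2 / q := by
  have hms : MeasurableSet {u : ℝ | 1 < |u|} := measurableSet_lt measurable_const measurable_norm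
  have hi := sk_mom_integrable (k + q + 1) k (by omega)
  have hi0 : Integrable (fun u : ℝ => |Real.sinc u| ^ (k + q + 1)) := by
    simpa using sk_mom_integrable (k + q + 1) 0 (by omega)
  have ht := sk_tail k q hq 1 one_pos
  rw [one_pow, inv_one, mul_one_div] at ht
  rw [← integral_add_compl hms hi, add_comm]
  refine add_le_add ?_ ht
  refine le_trans (setIntegral_mono_on hi.integrableOn hi0.integrableOn hms.compl ?_)
    (setIntegral_le_integral hi0 ?_)
  · intro u hu
    have hu : |u| ≤ 1 := not_lt.1 hu
    exact mul_le_of_le_one_left (by positivity) (pow_le_one₀ (abs_nonneg u) hu)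
  · filter_upwards with u
    positivity


lemma sk_num_tail (d : ℕ) (hd : 0 < d) (J : ℝ) (hJ : 8 / (3 * Real.sqrt (2 * d + 2)) ≤ J) :
    d * (2 * (((Real.sqrt ((2 * d + 2) / d)) ^ (2 * d + 1))⁻¹ / (2 * d + 1)) / J)
      ≤ 2 / (9 * Real.pi) := by
  have hd1 : (1:ℝ) ≤ d := by exact_mod_cast hd
  have hd0 : (0:ℝ) < d := by linarith
  set s := Real.sqrt (2 * d + 2) with hs
  have hs0 : 0 < s := Real.sqrt_pos.2 (by positivity)
  set t := Real.sqrt d with ht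
  have ht0 : 0 < t := Real.sqrt_pos.2 hd0
  have ht2 : t ^ 2 = d := Real.sq_sqrt hd0.le
  have hJ0 : 0 < J := lt_of_lt_of_le (by positivity) hJ
  have ha : Real.sqrt ((2 * d + 2) / d) = s / t := Real.sqrt_div (by positivity) _
  have ha2 : (s / t) ^ 2 = 2 * (1 + 1 / d) := by
    rw [div_pow, ht2, hs, Real.sq_sqrt (by positivity)]; field_simp
  have hpow : 2 ^ d * 2 * (s / t) ≤ (s / t) ^ (2 * d + 1) := by
    rw [pow_succ, pow_mul, ha2, mul_pow]
    have : 1 + (d:ℝ) * (1 / d) ≤ (1 + 1 / d) ^ d := one_add_mul_le_pow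
      (by have : 0 ≤ 1 / (d:ℝ) := by positivity
          linarith) d
    rw [mul_one_div_cancel hd0.ne'] at this
    gcongr
    linarith
  have h2d : 2 * (d:ℝ) + 1 ≤ 3 / 2 * 2 ^ d := by
    have : ∀ m : ℕ, 2 * ((m + 1 : ℕ) : ℝ) + 1 ≤ 3 / 2 * 2 ^ (m + 1) := by
      intro m
      induction m with
      | zero => norm_num
      | succ m ih =>
        rw [pow_succ]
        push_cast at ih ⊢
        nlinarith [(Nat.cast_nonneg m : (0:ℝ) ≤ m)]
    obtain ⟨m, rfl⟩ : ∃ m, d = m + 1 := ⟨d - 1, by omega⟩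
    exact this m
  have htd : t ≤ (d + 1) / 2 := by nlinarith [sq_nonneg (t - 1)]
  rw [ha]
  have hprod : 2 ^ d * 16 / (3 * t) ≤ (s / t) ^ (2 * d + 1) * J := by
    calc 2 ^ d * 16 / (3 * t) = 2 ^ d * 2 * (s / t) * (8 / (3 * s)) := by field_simp; norm_num
      _ ≤ _ := by gcongr
  have hQ : 0 < (2:ℝ) ^ d * 16 / (3 * t) := by positivity
  calc d * (2 * (((s / t) ^ (2 * d + 1))⁻¹ / (2 * d + 1)) / J)
      = 2 * d / (2 * d + 1) * ((s / t) ^ (2 * d + 1) * J)⁻¹ := by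
        rw [mul_inv]; field_simp
    _ ≤ 2 * d / (2 * d + 1) * (2 ^ d * 16 / (3 * t))⁻¹ := by gcongr
    _ = (6 * d * t) / ((2 * d + 1) * (2 ^ d * 16)) := by field_simp; norm_num
    _ ≤ 9 / 128 := by
        rw [div_le_div_iff₀ (by positivity) (by norm_num)]
        have h1 : 6 * d * t ≤ 6 * d * ((d + 1) / 2) := by gcongr
        have h2 : (2 * (d:ℝ) + 1) * (2 * d + 1) ≤ (2 * d + 1) * (3 / 2 * 2 ^ d) := by gcongr
        nlinarith
    _ ≤ 2 / (9 * Real.pi) := by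
        rw [div_le_div_iff₀ (by norm_num) (by positivity)]
        linarith [Real.pi_lt_d4]

lemma sk_num_a (n : ℝ) (hn : 4 ≤ n) :
    1 + 3 / 4 * Real.sqrt n ≤ 2 * Real.sqrt (2 * n / Real.pi) := by
  have hs2 : (2:ℝ) ≤ Real.sqrt n := by
    rw [Real.le_sqrt (by norm_num) (by positivity)]; linarith
  have h : Real.sqrt (25 / 64 * n) ≤ Real.sqrt (2 * n / Real.pi) := by
    apply Real.sqrt_le_sqrt
    rw [le_div_iff₀ Real.pi_pos]
    nlinarith [Real.pi_lt_d4]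
  rw [Real.sqrt_mul (by norm_num), show (25:ℝ)/64 = (5/8)^2 by norm_num,
    Real.sqrt_sq (by norm_num)] at h
  linarith

lemma sk_num_b (n : ℝ) (hn : 6 ≤ n) :
    1 + 3 / 4 * Real.sqrt n / (n / 2) ≤ Real.sqrt (2 * n / Real.pi) := by
  have hs2 : (2.4:ℝ) ≤ Real.sqrt n := by
    rw [Real.le_sqrt (by norm_num) (by positivity)]; norm_num; linarith
  have hsq : Real.sqrt n ^ 2 = n := Real.sq_sqrt (by positivity)
  have h : Real.sqrt (9 / 16 * n) ≤ Real.sqrt (2 * n / Real.pi) := by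
    apply Real.sqrt_le_sqrt
    rw [le_div_iff₀ Real.pi_pos]
    nlinarith [Real.pi_lt_d4]
  rw [Real.sqrt_mul (by norm_num), show (9:ℝ)/16 = (3/4)^2 by norm_num,
    Real.sqrt_sq (by norm_num)] at h
  refine le_trans ?_ h
  set s := Real.sqrt n
  rw [← hsq]
  have : 3 / 4 * s / (s ^ 2 / 2) = 3 / (2 * s) := by field_simp; norm_num
  rw [this]
  have : 3 / (2 * s) ≤ 3 / 4 * s - 1 := by
    rw [div_le_iff₀ (by positivity)]
    nlinarith
  linarith

/-- moment ratio -/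
def skR (d k : ℕ) : ℝ :=
  (∫ u : ℝ, |u| ^ k * |Real.sinc u| ^ (2 * d + 2)) / ∫ u : ℝ, |Real.sinc u| ^ (2 * d + 2)

lemma sk_J_pos (d : ℕ) (hd : 0 < d) : 0 < ∫ u : ℝ, |Real.sinc u| ^ (2 * d + 2) := by
  refine lt_of_lt_of_le ?_ (sk_J_lower (2 * d + 2) (by omega))
  have : (0:ℝ) < ((2 * d + 2 : ℕ) : ℝ) := by positivity
  have := Real.sqrt_pos.2 this
  positivity

lemma skR_le (d : ℕ) (hd : 0 < d) (k q : ℕ) (hq : 1 ≤ q) (hk : k + q = 2 * d + 1) :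
    skR d k ≤ 1 + 3 / 4 * Real.sqrt (2 * d + 2) / q := by
  have h := sk_mom k q hq
  have hJ := sk_J_lower (2 * d + 2) (by omega)
  have hp := sk_J_pos d hd
  rw [hk] at h
  rw [skR, div_le_iff₀ hp]
  change _ ≤ _ at h
  refine h.trans ?_
  push_cast at hJ
  set J := ∫ u : ℝ, |Real.sinc u| ^ (2 * d + 2) with hJd
  change J + 2 / q ≤ _
  have hq' : (0:ℝ) < q := by exact_mod_cast hq
  have hs : 0 < Real.sqrt (2 * d + 2) := Real.sqrt_pos.2 (by positivity)
  rw [div_le_iff₀ (by positivity)] at hJ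
  have : 2 / (q:ℝ) ≤ 3 / 4 * Real.sqrt (2 * d + 2) / q * J := by
    rw [div_mul_eq_mul_div]
    gcongr
    linarith
  linarith

lemma skR_nonneg (d k : ℕ) : 0 ≤ skR d k :=
  div_nonneg (integral_nonneg fun u => by positivity) (integral_nonneg fun u => by positivity)

lemma skR_a (d : ℕ) (hd : 0 < d) (k : ℕ) (hk : k ≤ 2 * d) :
    skR d k ≤ 2 * Real.sqrt (2 * (2 * d + 2) / Real.pi) := by
  have hd1 : (1:ℝ) ≤ d := by exact_mod_cast hd
  refine (skR_le d hd k (2 * d + 1 - k) (by omega) (by omega)).trans ?_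
  refine le_trans ?_ (sk_num_a (2 * d + 2) (by linarith))
  have : (1:ℝ) ≤ ((2 * d + 1 - k : ℕ) : ℝ) := by exact_mod_cast (by omega : 1 ≤ 2 * d + 1 - k)
  gcongr
  exact div_le_self (by positivity) this

lemma skR_b (d : ℕ) (hd : 2 ≤ d) (k : ℕ) (hk : k ≤ d) :
    skR d k ≤ Real.sqrt (2 * (2 * d + 2) / Real.pi) := by
  have hd1 : (2:ℝ) ≤ d := by exact_mod_cast hd
  refine (skR_le d (by omega) k (2 * d + 1 - k) (by omega) (by omega)).trans ?_
  refine le_trans ?_ (sk_num_b (2 * d + 2) (by linarith))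
  have : (d + 1 : ℝ) ≤ ((2 * d + 1 - k : ℕ) : ℝ) := by
    exact_mod_cast (by omega : d + 1 ≤ 2 * d + 1 - k)
  gcongr
  linarith

lemma skR_prod (d : ℕ) (hd : 0 < d) (β : Fin d → ℕ) (hβ : ∑ i, β i ≤ 2 * d) :
    ∏ i, skR d (β i) ≤ 2 * Real.sqrt (2 * (2 * d + 2) / Real.pi) ^ d := by
  have : Nonempty (Fin d) := ⟨⟨0, hd⟩⟩
  obtain ⟨i0, -, hi0⟩ := Finset.exists_max_image Finset.univ β Finset.univ_nonempty
  set S := Real.sqrt (2 * (2 * d + 2) / Real.pi)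
  have hS : 0 ≤ S := Real.sqrt_nonneg _
  rw [← Finset.mul_prod_erase _ _ (Finset.mem_univ i0)]
  have h1 : skR d (β i0) ≤ 2 * S :=
    skR_a d hd _ ((Finset.single_le_sum (fun i _ => Nat.zero_le _) (Finset.mem_univ i0)).trans hβ)
  have h2 : ∏ i ∈ Finset.univ.erase i0, skR d (β i) ≤ ∏ i ∈ Finset.univ.erase i0, S := by
    apply Finset.prod_le_prod (fun i _ => skR_nonneg _ _)
    intro i hi
    have hne : i ≠ i0 := Finset.ne_of_mem_erase hi
    have hd2 : 2 ≤ d := by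
      have := Fin.val_ne_of_ne hne
      have := i.2; have := i0.2
      omega
    apply skR_b d hd2
    have h3 := hi0 i (Finset.mem_univ i)
    have h4 : β i + β i0 ≤ ∑ i, β i := by
      rw [← Finset.sum_pair hne]
      exact Finset.sum_le_sum_of_subset (Finset.subset_univ _)
    omega
  have hcard : ∏ i ∈ Finset.univ.erase i0, S = S ^ (d - 1) := by
    rw [Finset.prod_const, Finset.card_erase_of_mem (Finset.mem_univ _)]; simp
  rw [hcard] at h2
  calc _ ≤ (2 * S) * S ^ (d - 1) := by
        apply mul_le_mul h1 h2 (Finset.prod_nonneg fun i _ => skR_nonneg _ _) (by positivity)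
    _ = 2 * S ^ d := by
        rw [mul_assoc, ← pow_succ']; congr 2; omega

lemma sk_rhs (d r : ℕ) :
    (2:ℝ) ^ (1 + (d : ℝ) / 2) * Real.pi ^ (-(d : ℝ) / 2) * (2 * d + 2 : ℝ) ^ ((r : ℝ) + (d : ℝ) / 2)
      = (2 * d + 2) ^ r * (2 * Real.sqrt (2 * (2 * d + 2) / Real.pi) ^ d) := by
  have hn : (0:ℝ) < 2 * d + 2 := by positivity
  have hp := Real.pi_pos
  rw [Real.rpow_add two_pos, Real.rpow_one, Real.rpow_add hn, Real.rpow_natCast,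
    Real.sqrt_eq_rpow, ← Real.rpow_natCast _ d, ← Real.rpow_mul (by positivity),
    show (1/2 * d : ℝ) = d / 2 by ring, Real.div_rpow (by positivity) hp.le,
    Real.mul_rpow two_pos.le hn.le, neg_div, Real.rpow_neg hp.le]
  ring

lemma sk_eprod {d : ℕ} {𝕜 : Type*} [RCLike 𝕜] (g : Fin d → ℝ → 𝕜) :
    ∫ x : EuclideanSpace ℝ (Fin d), ∏ i, g i (x i) = ∏ i, ∫ t, g i t := by
  rw [← integral_fintype_prod_volume_eq_prod, ← (PiLp.volume_preserving_toLp (Fin d)).integral_comp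
    (MeasurableEquiv.toLp 2 (Fin d → ℝ)).measurableEmbedding]

lemma sk_eprod_integrable {d : ℕ} {𝕜 : Type*} [RCLike 𝕜] (g : Fin d → ℝ → 𝕜)
    (h : ∀ i, Integrable (g i)) :
    Integrable (fun x : EuclideanSpace ℝ (Fin d) => ∏ i, g i (x i)) := by
  rw [← (PiLp.volume_preserving_toLp (Fin d)).integrable_comp_emb
    (MeasurableEquiv.toLp 2 (Fin d → ℝ)).measurableEmbedding]
  exact Integrable.fintype_prod h

/-- one-dimensional kernel -/
def skf (d : ℕ) (t : ℝ) : ℝ := |Real.sinc (t / (2 * d + 2))| ^ (2 * d + 2)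

lemma skf_nonneg (d : ℕ) (t : ℝ) : 0 ≤ skf d t := by unfold skf; positivity

lemma skf_cont (d : ℕ) : Continuous (skf d) := by
  have := Real.continuous_sinc
  unfold skf
  fun_prop

lemma skf_mom (d k : ℕ) :
    ∫ t, |t| ^ k * skf d t =
      (2 * d + 2) ^ (k + 1) * ∫ u : ℝ, |u| ^ k * |Real.sinc u| ^ (2 * d + 2) := by
  have hn : (0:ℝ) < 2 * d + 2 := by positivity
  have h := Measure.integral_comp_div (fun u : ℝ => |u| ^ k * |Real.sinc u| ^ (2 * d + 2))
    (2 * d + 2 : ℝ)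
  rw [abs_of_pos hn, smul_eq_mul] at h
  rw [pow_succ, mul_assoc, ← h, ← integral_const_mul]
  congr 1; ext t
  rw [abs_div, abs_of_pos hn, skf, div_pow]
  field_simp

lemma skf_int (d : ℕ) :
    ∫ t, skf d t = (2 * d + 2) * ∫ u : ℝ, |Real.sinc u| ^ (2 * d + 2) := by
  simpa using skf_mom d 0

lemma skf_tail (d : ℕ) (a : ℝ) (ha : 0 < a) :
    ∫ t, ({t : ℝ | (2 * d + 2) * a < |t|}).indicator (skf d) t ≤
      (2 * d + 2) * (2 * ((a ^ (2 * d + 1))⁻¹ / (2 * d + 1))) := by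
  have hn : (0:ℝ) < 2 * d + 2 := by positivity
  have h := Measure.integral_comp_div ({u : ℝ | a < |u|}.indicator
    (fun u : ℝ => |Real.sinc u| ^ (2 * d + 2))) (2 * d + 2 : ℝ)
  have hms : MeasurableSet {u : ℝ | a < |u|} := measurableSet_lt measurable_const measurable_norm
  rw [abs_of_pos hn, smul_eq_mul, integral_indicator hms] at h
  have ht := sk_tail 0 (2 * d + 1) (by omega) a ha
  simp only [pow_zero, one_mul, zero_add] at ht
  push_cast at ht
  calc _ = _ := ?_
    _ ≤ _ := mul_le_mul_of_nonneg_left ht hn.le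
  rw [← h]
  congr 1; ext t
  have e : t ∈ {t : ℝ | (2 * d + 2) * a < |t|} ↔ t / (2 * d + 2) ∈ {u : ℝ | a < |u|} := by
    change (2 * d + 2) * a < |t| ↔ a < |t / (2 * d + 2)|
    rw [abs_div, abs_of_pos hn, lt_div_iff₀ hn, mul_comm]
  by_cases h1 : t ∈ {t : ℝ | (2 * d + 2) * a < |t|}
  · rw [Set.indicator_of_mem h1, Set.indicator_of_mem (e.1 h1), skf]
  · rw [Set.indicator_of_notMem h1, Set.indicator_of_notMem (fun h => h1 (e.2 h))]

lemma skf_integrable (d k : ℕ) (hk : k ≤ 2 * d) :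
    Integrable (fun t => skf d t * (1 + |t|) ^ k) := by
  have hn : (1:ℝ) ≤ 2 * d + 2 := by
    have : (0:ℝ) ≤ d := by positivity
    linarith
  have h := ((sk_integrable (2 * d + 2) k (by omega)).comp_div
    (by positivity : (2 * d + 2 : ℝ) ≠ 0)).const_mul ((2 * d + 2) ^ k)
  refine h.mono' ?_ ?_
  · have := skf_cont d
    exact Continuous.aestronglyMeasurable (by fun_prop)
  · filter_upwards with t
    have := skf_nonneg d t
    rw [Real.norm_of_nonneg (by positivity)]
    calc skf d t * (1 + |t|) ^ k ≤ skf d t * ((2 * d + 2) * (1 + |t / (2 * d + 2)|)) ^ k := by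
          gcongr
          rw [abs_div, abs_of_pos (by positivity : (0:ℝ) < 2 * d + 2), mul_add, mul_div_cancel₀ _ (by positivity)]
          linarith
      _ = _ := by rw [mul_pow, skf]; ring

lemma skf_integrable0 (d : ℕ) : Integrable (skf d) := by
  simpa using skf_integrable d 0 (by omega)

lemma skf_fourier (d : ℕ) (hd : 0 < d) (z : ℝ) (hz : 1 < |z|) :
    ∫ t : ℝ, Complex.exp (Complex.I * (z * t : ℝ)) * (skf d t : ℝ) = 0 := by
  have hn : (0:ℝ) < 2 * d + 2 := by positivity
  have h0 := sk_fourier (2 * d + 2) (by omega) ((2 * d + 2) * z) (by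
    rw [abs_mul, abs_of_pos hn]; push_cast; nlinarith)
  have h := Measure.integral_comp_div (fun t : ℝ => Complex.exp (Complex.I *
    (((2 * d + 2) * z) * t : ℝ)) * (Real.sinc t ^ (2 * d + 2) : ℝ)) (2 * d + 2 : ℝ)
  rw [h0, smul_zero] at h
  rw [← h]
  congr 1; ext t
  rw [skf, Even.pow_abs ⟨d + 1, by ring⟩]
  congr 4
  field_simp

/-- the kernel -/
def skρ (d : ℕ) (x : EuclideanSpace ℝ (Fin d)) : ℝ :=
  ((∫ t, skf d t) ^ d)⁻¹ * ∏ i, skf d (x i)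

lemma skf_int_pos (d : ℕ) (hd : 0 < d) : 0 < ∫ t, skf d t := by
  rw [skf_int]
  have := sk_J_pos d hd
  positivity

lemma skρ_nonneg (d : ℕ) (x : EuclideanSpace ℝ (Fin d)) : 0 ≤ skρ d x := by
  have : 0 ≤ ∫ t, skf d t := integral_nonneg (skf_nonneg d)
  exact mul_nonneg (by positivity) (Finset.prod_nonneg fun i _ => skf_nonneg d _)

lemma skρ_cont (d : ℕ) : Continuous (skρ d) := by
  have := skf_cont d
  unfold skρ
  fun_prop

lemma skρ_integrable_prod (d k : ℕ) (hk : k ≤ 2 * d) :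
    Integrable (fun x => skρ d x * (∏ i, (1 + |x i|)) ^ k) := by
  have := (sk_eprod_integrable (d := d) (fun i t => skf d t * (1 + |t|) ^ k)
    (fun i => skf_integrable d k hk)).const_mul ((∫ t, skf d t) ^ d)⁻¹
  refine this.congr ?_
  filter_upwards with x
  rw [skρ, Finset.prod_mul_distrib, Finset.prod_pow]
  ring

lemma sk_sum_le_prod {d : ℕ} (x : Fin d → ℝ) : ∑ i, |x i| ≤ ∏ i, (1 + |x i|) := by
  have h : ∀ s : Finset (Fin d), 1 + ∑ i ∈ s, |x i| ≤ ∏ i ∈ s, (1 + |x i|) := by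
    intro s
    induction s using Finset.induction_on with
    | empty => simp
    | insert a s ha ih =>
      rw [Finset.sum_insert ha, Finset.prod_insert ha]
      have h1 : 0 ≤ ∑ i ∈ s, |x i| := Finset.sum_nonneg fun i _ => abs_nonneg _
      nlinarith [abs_nonneg (x a)]
  linarith [h Finset.univ]

lemma skρ_integrable_sum (d k : ℕ) (hk : k ≤ 2 * d) :
    Integrable (fun x => skρ d x * (∑ i, |x i|) ^ k) := by
  refine (skρ_integrable_prod d k hk).mono' ?_ ?_
  · have := skρ_cont d
    exact Continuous.aestronglyMeasurable (by fun_prop)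
  · filter_upwards with x
    have := skρ_nonneg d x
    rw [Real.norm_of_nonneg (by positivity)]
    gcongr
    exact sk_sum_le_prod (fun i => x i)

lemma skρ_integrable (d : ℕ) : Integrable (skρ d) := by
  simpa using skρ_integrable_sum d 0 (by omega)

lemma skρ_integrable_norm (d k : ℕ) (hk : k ≤ 2 * d) :
    Integrable (fun x => ‖x‖ ^ k * ‖(skρ d x : ℂ)‖) := by
  refine (skρ_integrable_sum d k hk).mono' ?_ ?_
  · have := skρ_cont d
    exact Continuous.aestronglyMeasurable (by fun_prop)
  · filter_upwards with x
    have := skρ_nonneg d x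
    rw [Real.norm_of_nonneg (by positivity), Complex.norm_real, Real.norm_of_nonneg this, mul_comm]
    gcongr
    rw [EuclideanSpace.norm_eq, Real.sqrt_le_left (Finset.sum_nonneg fun i _ => abs_nonneg _)]
    simp only [Real.norm_eq_abs]
    exact Finset.sum_sq_le_sq_sum_of_nonneg (fun i _ => abs_nonneg _)

lemma skρ_int (d : ℕ) (hd : 0 < d) : ∫ x, skρ d x = 1 := by
  unfold skρ
  rw [integral_const_mul, sk_eprod (fun _ => skf d), Finset.prod_const, Finset.card_univ,
    Fintype.card_fin, inv_mul_cancel₀]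
  have := skf_int_pos d hd
  positivity

lemma skρ_mom (d : ℕ) (hd : 0 < d) (β : Fin d → ℕ) :
    ∫ x, (∏ i, |x i| ^ β i) * skρ d x = (2 * d + 2) ^ (∑ i, β i) * ∏ i, skR d (β i) := by
  have hJ := sk_J_pos d hd
  have h : ∀ x : EuclideanSpace ℝ (Fin d), (∏ i, |x i| ^ β i) * skρ d x =
      ((∫ t, skf d t) ^ d)⁻¹ * ∏ i, (|x i| ^ β i * skf d (x i)) := by
    intro x; rw [skρ, Finset.prod_mul_distrib]; ring
  simp_rw [h]
  rw [integral_const_mul, sk_eprod (fun i t => |t| ^ β i * skf d t)]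
  simp_rw [skf_mom, skf_int, skR]
  rw [Finset.prod_mul_distrib, Finset.prod_div_distrib, Finset.prod_const, Finset.card_univ,
    Fintype.card_fin, Finset.prod_pow_eq_pow_sum, Finset.sum_add_distrib]
  simp only [Finset.sum_const, Finset.card_univ, Fintype.card_fin, smul_eq_mul, mul_one]
  rw [pow_add, mul_pow]
  field_simp

lemma skρ_ball (d : ℕ) (hd : 0 < d) :
    1 - 2 / (9 * Real.pi) ≤ ∫ x in Metric.closedBall (0 : EuclideanSpace ℝ (Fin d))
              ((2 * d + 2 : ℝ) ^ ((3 : ℝ) / 2)), skρ d x := by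
  have hJ := sk_J_pos d hd
  have hI := skf_int_pos d hd
  have hn : (0:ℝ) < 2 * d + 2 := by positivity
  have hd0 : (0:ℝ) < d := by exact_mod_cast hd
  set R := (2 * d + 2 : ℝ) ^ ((3 : ℝ) / 2) with hR
  set B := Metric.closedBall (0 : EuclideanSpace ℝ (Fin d)) R with hB
  have hR0 : 0 ≤ R := by positivity
  have hR2 : R ^ 2 = (2 * d + 2) ^ 3 := by
    rw [hR, ← Real.rpow_natCast, ← Real.rpow_mul hn.le, ← Real.rpow_natCast]; norm_num
  have hsplit := integral_add_compl (s := B) Metric.isClosed_closedBall.measurableSet (skρ_integrable d)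
  rw [skρ_int d hd] at hsplit
  set a := Real.sqrt ((2 * d + 2) / d) with ha
  have ha0 : 0 < a := Real.sqrt_pos.2 (by positivity)
  have ha2 : a ^ 2 = (2 * d + 2) / d := Real.sq_sqrt (by positivity)
  set S : Set ℝ := {t : ℝ | (2 * d + 2) * a < |t|} with hS
  have hms : MeasurableSet S := measurableSet_lt measurable_const measurable_norm
  let G : Fin d → Fin d → ℝ → ℝ := fun i k => if k = i then S.indicator (skf d) else skf d
  have hGi : ∀ i k, Integrable (G i k) := by
    intro i k
    by_cases h : k = i
    · simp only [G, h, if_true]; exact (skf_integrable0 d).indicator hms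
    · simp only [G, h, if_false]; exact skf_integrable0 d
  have hGn : ∀ i k t, 0 ≤ G i k t := by
    intro i k t
    by_cases h : k = i
    · simp only [G, h, if_true]; exact Set.indicator_nonneg (fun x _ => skf_nonneg d x) t
    · simp only [G, h, if_false]; exact skf_nonneg d t
  have hC : (∫ x in Bᶜ, skρ d x) ≤ 2 / (9 * Real.pi) := by
    calc (∫ x in Bᶜ, skρ d x) ≤ ∫ x : EuclideanSpace ℝ (Fin d),
          ∑ i, ((∫ t, skf d t) ^ d)⁻¹ * ∏ k, G i k (x k) := by
          rw [← integral_indicator Metric.isClosed_closedBall.measurableSet.compl]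
          apply integral_mono ((skρ_integrable d).indicator
            Metric.isClosed_closedBall.measurableSet.compl)
          · exact integrable_finsetSum _ fun i _ => (sk_eprod_integrable (G i) (hGi i)).const_mul _
          intro x
          have hnn : ∀ i, 0 ≤ ((∫ t, skf d t) ^ d)⁻¹ * ∏ k, G i k (x k) := fun i =>
            mul_nonneg (by positivity) (Finset.prod_nonneg fun k _ => hGn i k _)
          by_cases hx : x ∈ Bᶜ
          · rw [Set.indicator_of_mem hx]
            have hx' : R < ‖x‖ := by
              by_contra! h
              exact hx (by rw [hB, mem_closedBall_zero_iff]; exact h)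
            have hx2 : R ^ 2 < ∑ i, |x i| ^ 2 := by
              have := pow_lt_pow_left₀ hx' hR0 two_ne_zero
              rwa [EuclideanSpace.norm_sq_eq] at this
            obtain ⟨i, hi⟩ : ∃ i, (2 * d + 2) * a < |x i| := by
              by_contra! h
              have : ∑ i, |x i| ^ 2 ≤ ∑ i : Fin d, ((2 * d + 2) * a) ^ 2 :=
                Finset.sum_le_sum fun i _ => pow_le_pow_left₀ (abs_nonneg _) (h i) 2
              rw [Finset.sum_const, Finset.card_univ, Fintype.card_fin, nsmul_eq_mul, mul_pow, ha2] at this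
              have e : (d:ℝ) * ((2 * d + 2) ^ 2 * ((2 * d + 2) / d)) = (2 * d + 2) ^ 3 := by
                field_simp
              rw [e] at this
              linarith
            refine le_trans (le_of_eq ?_) (Finset.single_le_sum (fun i _ => hnn i) (Finset.mem_univ i))
            rw [skρ]
            congr 1
            apply Finset.prod_congr rfl
            intro k _
            by_cases h : k = i
            · subst h
              simp only [G, if_true]
              rw [Set.indicator_of_mem (by exact hi)]
            · simp only [G, h, if_false]
          · rw [Set.indicator_of_notMem hx]
            exact Finset.sum_nonneg fun i _ => hnn i
      _ = ∑ i : Fin d, ((∫ t, skf d t) ^ d)⁻¹ * ((∫ t, S.indicator (skf d) t) * (∫ t, skf d t) ^ (d - 1)) := by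
          rw [integral_finsetSum _ fun i _ => (sk_eprod_integrable (G i) (hGi i)).const_mul _]
          apply Finset.sum_congr rfl
          intro i _
          rw [integral_const_mul, sk_eprod, ← Finset.mul_prod_erase _ _ (Finset.mem_univ i)]
          congr 2
          · simp [G]
          · rw [Finset.prod_congr rfl (g := fun _ => ∫ t, skf d t)]
            · rw [Finset.prod_const, Finset.card_erase_of_mem (Finset.mem_univ _)]; simp
            · intro k hk
              simp [G, Finset.ne_of_mem_erase hk]
      _ = d * ((∫ t, S.indicator (skf d) t) / ∫ t, skf d t) := by
          rw [Finset.sum_const, Finset.card_univ, Fintype.card_fin, nsmul_eq_mul]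
          obtain ⟨m, hm⟩ : ∃ m, d = m + 1 := ⟨d - 1, by omega⟩
          have : (∫ t, skf d t) ^ d = (∫ t, skf d t) ^ (d - 1) * ∫ t, skf d t := by
            rw [← pow_succ]; congr 1; omega
          rw [this]
          field_simp
      _ ≤ d * (((2 * d + 2) * (2 * ((a ^ (2 * d + 1))⁻¹ / (2 * d + 1)))) / ∫ t, skf d t) := by
          gcongr
          exact skf_tail d a ha0
      _ = d * ((2 * ((a ^ (2 * d + 1))⁻¹ / (2 * d + 1))) / ∫ u : ℝ, |Real.sinc u| ^ (2 * d + 2)) := by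
          rw [skf_int, mul_div_mul_left _ _ hn.ne']
      _ ≤ _ := by
          apply sk_num_tail d hd
          have := sk_J_lower (2 * d + 2) (by omega)
          push_cast at this
          exact this
  linarith

/-- bilinear form -/
def skL (d : ℕ) : EuclideanSpace ℝ (Fin d) →L[ℝ] EuclideanSpace ℝ (Fin d) →L[ℝ] ℝ :=
  (-(2 * Real.pi)⁻¹) • innerSL ℝ

lemma skL_apply (d : ℕ) (x y : EuclideanSpace ℝ (Fin d)) :
    skL d x y = -(2 * Real.pi)⁻¹ * ∑ i, y i * x i := by
  have h : skL d x y = -(2 * Real.pi)⁻¹ * inner ℝ x y := by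
    simp only [skL, smul_apply, smul_eq_mul]
    rfl
  rw [h, PiLp.inner_apply]
  simp

lemma sk_fd_eq (d : ℕ) : fourierDensity (skρ d) = VectorFourier.fourierIntegral Real.fourierChar volume
    (skL d).toLinearMap₁₂ (fun x => (skρ d x : ℂ)) := by
  ext ζ
  rw [VectorFourier.fourierIntegral, fourierDensity]
  congr 1; ext x
  have : (skL d).toLinearMap₁₂ x ζ = skL d x ζ := rfl
  rw [this, skL_apply, Circle.smul_def, Real.fourierChar_apply, smul_eq_mul]
  congr 2
  push_cast
  have : (Real.pi:ℂ) ≠ 0 := by exact_mod_cast Real.pi_ne_zero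
  field_simp

lemma sk_fd_prod (d : ℕ) (ζ : EuclideanSpace ℝ (Fin d)) : fourierDensity (skρ d) ζ =
    ((((∫ t, skf d t) ^ d)⁻¹ : ℝ) : ℂ) *
      ∏ i, ∫ t : ℝ, Complex.exp (Complex.I * (ζ i * t : ℝ)) * (skf d t : ℝ) := by
  rw [← sk_eprod (fun i (t : ℝ) => Complex.exp (Complex.I * (ζ i * t : ℝ)) * ((skf d t : ℝ) : ℂ)),
    ← integral_const_mul, fourierDensity]
  congr 1; ext x
  rw [Finset.prod_mul_distrib, ← Complex.exp_sum, ← Finset.mul_sum, skρ]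
  push_cast
  ring

lemma sk_pderiv (d : ℕ) (hd : 0 < d) (r : ℕ) (hr : r ≤ 2 * d) (j : Fin r → Fin d)
    (ζ : EuclideanSpace ℝ (Fin d)) :
    ‖pderivMulti (fourierDensity (skρ d)) r j ζ‖ ≤
      (2 * d + 2) ^ r * (2 * Real.sqrt (2 * (2 * d + 2) / Real.pi) ^ d) := by
  have hm : AEStronglyMeasurable (fun x => (skρ d x : ℂ)) := by
    have := skρ_cont d
    exact Continuous.aestronglyMeasurable (by fun_prop)
  have hi : Integrable (fun v => VectorFourier.fourierPowSMulRight (skL d)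
      (fun x => (skρ d x : ℂ)) v r) :=
    VectorFourier.integrable_fourierPowSMulRight _ (skρ_integrable_norm d r hr) hm
  rw [pderivMulti, sk_fd_eq, VectorFourier.iteratedFDeriv_fourierIntegral (N := ((2 * d : ℕ) : ℕ∞))
    (skL d) (fun n hn => skρ_integrable_norm d n (by exact_mod_cast hn)) hm (by exact_mod_cast hr),
    VectorFourier.fourierIntegral, ContinuousMultilinearMap.integral_apply]
  swap
  · exact (VectorFourier.fourierIntegral_convergent_iff Real.continuous_fourierChar
      (by exact (skL d).continuous₂) ζ).2 hi
  let β : Fin d → ℕ := fun i => (Finset.univ.filter fun k => j k = i).card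
  have hβ : ∑ i, β i = r := by
    have := Finset.card_eq_sum_card_fiberwise (f := j) (s := Finset.univ) (t := Finset.univ)
      (fun _ _ => Finset.mem_coe.2 (Finset.mem_univ _))
    simpa [β] using this.symm
  have hpt : ∀ x : EuclideanSpace ℝ (Fin d),
      ‖(Real.fourierChar (-(skL d).toLinearMap₁₂ x ζ) • VectorFourier.fourierPowSMulRight (skL d)
      (fun x => (skρ d x : ℂ)) x r) fun k => EuclideanSpace.single (j k) 1‖
      = (∏ i, |x i| ^ β i) * skρ d x := by
    intro x
    have e1 : ∏ i, |x i| ^ β i = ∏ k, |x (j k)| := by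
      simp only [β]
      rw [← Finset.prod_fiberwise Finset.univ j]
      apply Finset.prod_congr rfl
      intro i _
      rw [← Finset.prod_const]
      apply Finset.prod_congr rfl
      intro k hk
      rw [(Finset.mem_filter.1 hk).2]
    have hc : ∀ k, skL d x (EuclideanSpace.single (j k) 1) = -(2 * Real.pi)⁻¹ * x (j k) := by
      intro k
      rw [skL_apply]
      congr 1
      simp
    rw [Circle.smul_def, smul_apply, norm_smul, Circle.norm_coe, one_mul, VectorFourier.fourierPowSMulRight_apply,
      norm_smul, norm_smul, Complex.norm_real, Real.norm_of_nonneg (skρ_nonneg d x), e1]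
    simp_rw [hc]
    rw [Finset.prod_mul_distrib, norm_mul, Finset.prod_const, Finset.card_univ, Fintype.card_fin,
      norm_pow, norm_pow, norm_neg, norm_neg, norm_inv, norm_prod]
    have : ‖(2 * Real.pi * Complex.I : ℂ)‖ = 2 * Real.pi := by
      simp [abs_of_pos Real.pi_pos]
    rw [this, Real.norm_of_nonneg (by positivity : 0 ≤ 2 * Real.pi), inv_pow]
    simp only [Real.norm_eq_abs]
    have := Real.pi_pos
    field_simp
  refine (norm_integral_le_integral_norm _).trans ?_
  simp_rw [hpt]
  rw [skρ_mom d hd, hβ]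
  gcongr
  exact skR_prod d hd β (hβ.le.trans hr)

/-- There exists a probability density `ρ` on `ℝ^d` — namely
`ρ(x)` proportional to `∏_{i=1}^d (sinc(x⁽ⁱ⁾/(2d+2)))^{2d+2}` — such that:
(1) `ρ ≥ 0`, `∫ ρ = 1`, and `∫_{B(0,(2d+2)^{3/2})} ρ ≥ c₂` with `2c₂ − 1 ≥ 1 − 4/(9π)`;
(2) `ρ` integrates `(‖x‖₁)^{d+1}`;
(3) the Fourier transform `ρ̂` is supported in the cube `[−1,1]^d`;
(4) `ρ̂` is of class `C^{2d}` and, for every multi-index `β` with `|β| ≤ 2d`,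
`‖∂^{|β|}ρ̂/∂ζ^β‖_∞ ≤ 2^{1+d/2} π^{−d/2} (2d+2)^{|β|+d/2}`. -/
theorem exists_smoothing_kernel (d : ℕ) (hd : 0 < d) :
    ∃ ρ : EuclideanSpace ℝ (Fin d) → ℝ,
      -- the kernel is proportional to ∏ᵢ (sinc(xᶦ/(2d+2)))^{2d+2}
      (∃ c : ℝ, 0 < c ∧ ∀ x, ρ x = c * ∏ i, sinc (x i / (2 * d + 2)) ^ (2 * d + 2)) ∧
      -- (1)
      (∀ x, 0 ≤ ρ x) ∧ (∫ x, ρ x) = 1 ∧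
      (∃ c₂ : ℝ,
        c₂ ≤ (∫ x in Metric.closedBall (0 : EuclideanSpace ℝ (Fin d))
              ((2 * d + 2 : ℝ) ^ ((3 : ℝ) / 2)), ρ x) ∧
        1 - 4 / (9 * Real.pi) ≤ 2 * c₂ - 1) ∧
      -- (2)
      Integrable (fun x => ρ x * (∑ i, |x i|) ^ (d + 1)) ∧
      -- (3)
      (∀ ζ : EuclideanSpace ℝ (Fin d), (∃ i, 1 < |ζ i|) → fourierDensity ρ ζ = 0) ∧
      -- (4)
      ContDiff ℝ (2 * d : ℕ) (fourierDensity ρ) ∧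
      (∀ r : ℕ, r ≤ 2 * d → ∀ j : Fin r → Fin d, ∀ ζ,
        ‖pderivMulti (fourierDensity ρ) r j ζ‖ ≤
          2 ^ (1 + (d : ℝ) / 2) * Real.pi ^ (-(d : ℝ) / 2) *
            (2 * d + 2 : ℝ) ^ ((r : ℝ) + (d : ℝ) / 2)) := by
  have hc : ∀ x, skρ d x = ((∫ t, skf d t) ^ d)⁻¹ * ∏ i, sinc (x i / (2 * d + 2)) ^ (2 * d + 2) := by
    intro x
    rw [skρ]
    congr 1
    apply Finset.prod_congr rfl
    intro i _
    rw [skf, Even.pow_abs ⟨d + 1, by ring⟩]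
    rfl
  refine ⟨skρ d, ⟨((∫ t, skf d t) ^ d)⁻¹, ?_, hc⟩, skρ_nonneg d, skρ_int d hd,
    ⟨_, skρ_ball d hd, ?_⟩, skρ_integrable_sum d (d + 1) (by omega), ?_, ?_, ?_⟩
  · have := skf_int_pos d hd
    positivity
  · apply le_of_eq
    have := Real.pi_ne_zero
    field_simp
    ring
  · rintro ζ ⟨i, hi⟩
    rw [sk_fd_prod, Finset.prod_eq_zero (Finset.mem_univ i) (skf_fourier d hd _ hi), mul_zero]
  · rw [sk_fd_eq]
    exact VectorFourier.contDiff_fourierIntegral (N := ((2 * d : ℕ) : ℕ∞)) (skL d)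
      (fun n hn => skρ_integrable_norm d n (by exact_mod_cast hn))
  · intro r hr j ζ
    rw [sk_rhs]
    exact sk_pderiv d hd r hr j ζ

end
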